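/- Let N ≥ K ≥ 2 be integers with K − 1 < 2N/3 (i.e., rate R < 2/3 + 1/N), and let e, f be nonnegative real numbers with e + f ≤ N and e < (N − K + 1)/2 − f/3. Then T(2N − 2e − f) > 3N − f. That is, the decoding region e < (N−K+1)/2 − f/3 of the proposed multiplicity assignment strategy with M = 2 remains achievable for Reed–Solomon codes of rate below 2/3 + 1/N. -/

import Mathlib

/-- The Koetter–Vardy piecewise linear function: `T(S) = 0` for `S ≤ 0` and
`T(S) = (a+1)(S − (a/2)(K−1))` for `a(K−1) < S ≤ (a+1)(K−1)`, where for `S > 0`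
we have `a + 1 = ⌈S/(K−1)⌉`. -/
noncomputable def kvT (K : ℕ) (S : ℝ) : ℝ :=
  if S ≤ 0 then 0
  else (⌈S / ((K : ℝ) - 1)⌉ : ℝ) *
    (S - ((⌈S / ((K : ℝ) - 1)⌉ : ℝ) - 1) / 2 * ((K : ℝ) - 1))

/-- For positive scores `kvT K` dominates each of its linear pieces. -/
theorem linear_piece_le_kvT {K : ℕ} (hK : 2 ≤ K) {S : ℝ} (hS : 0 < S) (j : ℤ) :
    (j : ℝ) * (S - ((j : ℝ) - 1) / 2 * ((K : ℝ) - 1)) ≤ kvT K S := by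
  have hK' : (2 : ℝ) ≤ K := by exact_mod_cast hK
  have hD : 0 < (K : ℝ) - 1 := by linarith
  rw [kvT, if_neg (not_le.mpr hS)]
  set D : ℝ := (K : ℝ) - 1
  have h_upper : S ≤ (⌈S / D⌉ : ℝ) * D := (div_le_iff₀ hD).mp (Int.le_ceil _)
  have h_lower : ((⌈S / D⌉ : ℝ) - 1) * D < S :=
    (lt_div_iff₀ hD).mp (by linarith [Int.ceil_lt_add_one (S / D)])
  generalize ⌈S / D⌉ = m at h_upper h_lower ⊢
  rcases lt_trichotomy m j with h | rfl | h
  · have h' : (m : ℝ) + 1 ≤ j := by exact_mod_cast h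
    nlinarith [mul_nonneg (sub_nonneg.mpr h') hD.le,
      mul_nonneg (show (0 : ℝ) ≤ j - m by linarith) (sub_nonneg.mpr h_upper),
      mul_nonneg (show (0 : ℝ) ≤ j - m by linarith)
        (mul_nonneg (sub_nonneg.mpr h') hD.le)]
  · exact le_rfl
  · have h' : (j : ℝ) + 1 ≤ m := by exact_mod_cast h
    nlinarith [mul_nonneg (show (0 : ℝ) ≤ m - j by linarith) (sub_nonneg.mpr h_lower.le),
      mul_nonneg (show (0 : ℝ) ≤ m - j by linarith)
        (mul_nonneg (sub_nonneg.mpr h') hD.le)]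

/-- The decoding region `e < (N−K+1)/2 − f/3` of the proposed MAS with `M = 2`
remains achievable for RS codes of rate below `2/3 + 1/N`: if `K − 1 < 2N/3`,
`e + f ≤ N` and `e < (N−K+1)/2 − f/3`, then `T(2N − 2e − f) > 3N − f`. -/
theorem bgmd_region_M2_low_rate (N K : ℕ) (hK : 2 ≤ K) (hKN : K ≤ N)
    (hrate : (K : ℝ) - 1 < 2 * (N : ℝ) / 3)
    (e f : ℝ) (he : 0 ≤ e) (hf : 0 ≤ f) (hefN : e + f ≤ (N : ℝ))
    (hef : e < ((N : ℝ) - K + 1) / 2 - f / 3) :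
    kvT K (2 * (N : ℝ) - 2 * e - f) > 3 * (N : ℝ) - f := by
  have hK' : (2 : ℝ) ≤ K := by exact_mod_cast hK
  have h_piece := linear_piece_le_kvT hK
    (show 0 < 2 * (N : ℝ) - 2 * e - f by linarith) 3
  push_cast at h_piece
  linarith
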